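/- arXiv:2012.05129 — 2 statements merged into one kernel-verified Lean document; each statement's English description precedes it below -/
import Mathlib

section
/- Let N ≥ 2 and let A be the adjacency matrix of an unweighted simple graph on N nodes (A symmetric with entries in {0,1} and zero diagonal). Let A' = 𝟙 − A − I be the adjacency matrix of the complement graph. Then E(A') = E(A), where E(A) = min over all N×N permutation matrices P with trace 0 of (1/4)·‖A − P A Pᵀ‖₁ (Theorem 1 of the paper). -/
open Matrix BigOperators
open scoped Classical

/-- Entrywise ℓ¹ norm of a square matrix: sum of absolute values of all entries. -/
noncomputable def l1norm {ι : Type*} [Fintype ι] (M : Matrix ι ι ℝ) : ℝ :=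
  ∑ i, ∑ j, |M i j|

/-- The permutation matrix of a permutation σ: `P i j = 1` iff `σ j = i`. -/
noncomputable def permMat {ι : Type*} [Fintype ι] [DecidableEq ι]
    (σ : Equiv.Perm ι) : Matrix ι ι ℝ :=
  Matrix.of fun i j => if σ j = i then 1 else 0

/-- A matrix is a permutation matrix if it encodes some permutation. -/
def IsPermMatrix {ι : Type*} [Fintype ι] [DecidableEq ι] (P : Matrix ι ι ℝ) : Prop :=
  ∃ σ : Equiv.Perm ι, P = permMat σ

/-- 𝓔(A, P) = (1/4)·‖A − P A Pᵀ‖₁. -/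
noncomputable def Ecal {ι : Type*} [Fintype ι] (A P : Matrix ι ι ℝ) : ℝ :=
  (1 / 4) * l1norm (A - P * A * Pᵀ)

/-- E(A): minimum of 𝓔(A, P) over permutation matrices P with trace 0. -/
noncomputable def Easym {ι : Type*} [Fintype ι] [DecidableEq ι]
    (A : Matrix ι ι ℝ) : ℝ :=
  sInf {x : ℝ | ∃ P : Matrix ι ι ℝ, IsPermMatrix P ∧ Matrix.trace P = 0 ∧ x = Ecal A P}

/-- Conjugation by a permutation matrix reindexes rows and columns. -/
theorem permMat_conj_apply {ι : Type*} [Fintype ι] [DecidableEq ι]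
    (σ : Equiv.Perm ι) (A : Matrix ι ι ℝ) (i j : ι) :
    (permMat σ * A * (permMat σ)ᵀ) i j = A (σ.symm i) (σ.symm j) := by
  simp [permMat, Matrix.mul_apply, ← Equiv.eq_symm_apply]

/-- The asymmetry functional at a permutation matrix is invariant under complementation. -/
theorem Ecal_complement {ι : Type*} [Fintype ι] [DecidableEq ι]
    (A P : Matrix ι ι ℝ) (hP : IsPermMatrix P) :
    Ecal (Matrix.of (fun _ _ => (1 : ℝ)) - A - 1) P = Ecal A P := by
  obtain ⟨σ, rfl⟩ := hP
  unfold Ecal l1norm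
  congr 1
  refine Finset.sum_congr rfl fun i _ => Finset.sum_congr rfl fun j _ => ?_
  rw [← abs_neg]
  congr 1
  simp only [Matrix.sub_apply, permMat_conj_apply, Matrix.of_apply, Matrix.one_apply,
    EmbeddingLike.apply_eq_iff_eq]
  ring

/-- For a simple-graph adjacency matrix A on N ≥ 2 nodes,
the complement A' = 𝟙 − A − I satisfies E(A') = E(A). -/
theorem complement_Easym_eq {N : ℕ} (hN : 2 ≤ N)
    (A : Matrix (Fin N) (Fin N) ℝ)
    (hsymm : Aᵀ = A) (h01 : ∀ i j, A i j = 0 ∨ A i j = 1) (hdiag : ∀ i, A i i = 0) :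
    Easym (Matrix.of (fun _ _ => (1 : ℝ)) - A - 1) = Easym A := by
  unfold Easym
  congr 1
  ext x
  refine exists_congr fun P => and_congr_right fun hP => ?_
  rw [Ecal_complement A P hP]
end

section
/- Let N ≥ 2 and let A be the adjacency matrix of an unweighted simple graph on N nodes, with complement A' = 𝟙 − A − I. Then 𝒮(A') = 𝒮(A), where 𝒮(A) = E(A) / ((1/2)·C(N,2)) = min_P ‖A − P A Pᵀ‖₁ / (N(N−1)) is the normalized asymmetry measure, the minimum taken over permutation matrices P with trace 0. -/
open Matrix BigOperators
open scoped Classical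

/-- 𝒮(A) = E(A) / ((1/2)·C(N,2)): the normalized asymmetry measure. -/
noncomputable def Snorm {N : ℕ} (A : Matrix (Fin N) (Fin N) ℝ) : ℝ :=
  Easym A / ((1 / 2) * (N.choose 2 : ℝ))

theorem permMat_mul_mul_transpose {ι : Type*} [Fintype ι] [DecidableEq ι]
    (σ : Equiv.Perm ι) (M : Matrix ι ι ℝ) :
    permMat σ * M * (permMat σ)ᵀ = M.submatrix σ.symm σ.symm := by
  ext i j
  simp [permMat, Matrix.mul_apply, ← Equiv.eq_symm_apply]

theorem Easym_complement {ι : Type*} [Fintype ι] [DecidableEq ι] (A : Matrix ι ι ℝ) :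
    Easym (Matrix.of (fun _ _ => (1 : ℝ)) - A - 1) = Easym A := by
  unfold Easym
  congr 1
  ext x
  refine exists_congr fun P => and_congr_right fun hP => ?_
  rw [Ecal_complement A P hP]

/-- For a simple-graph adjacency matrix A on N ≥ 2 nodes,
the complement A' = 𝟙 − A − I satisfies 𝒮(A') = 𝒮(A). -/
theorem complement_Snorm_eq {N : ℕ} (hN : 2 ≤ N)
    (A : Matrix (Fin N) (Fin N) ℝ)
    (hsymm : Aᵀ = A) (h01 : ∀ i j, A i j = 0 ∨ A i j = 1) (hdiag : ∀ i, A i i = 0) :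
    Snorm (Matrix.of (fun _ _ => (1 : ℝ)) - A - 1) = Snorm A := by
  rw [Snorm, Easym_complement, Snorm]
end
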